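/- For every group-theoretical category of partitions C, the normal subgroup F(C) of Z_2^{*∞} is sS_∞-invariant, i.e. φ(F(C)) ⊆ F(C) for every φ in the strong symmetric semigroup sS_∞. -/

import Mathlib

open Classical

/-- A partition diagram with `upper` upper points and `lower` lower points; the blocks are
encoded by the equivalence relation (setoid) on the disjoint union of the points. -/
structure PartitionDiagram where
  upper : ℕ
  lower : ℕ
  rel : Setoid (Fin upper ⊕ Fin lower)

namespace PartitionDiagram

/-- The partition determined by a labelling of the points: two points lie in the same block
iff they receive the same label. -/
def ofLabels {u l : ℕ} (f : Fin u ⊕ Fin l → ℕ) : PartitionDiagram :=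
  ⟨u, l, Setoid.ker f⟩

/-- The identity partition `| ∈ P(1,1)`. -/
def idPartition : PartitionDiagram := ofLabels (u := 1) (l := 1) fun _ => 0

/-- The pair partition `⊓ ∈ P(0,2)`. -/
def pairPartition : PartitionDiagram := ofLabels (u := 0) (l := 2) fun _ => 0

/-- The four block partition `⊓⊓ ∈ P(0,4)`. -/
def fourBlock : PartitionDiagram := ofLabels (u := 0) (l := 4) fun _ => 0

/-- The singleton partition `↑ ∈ P(0,1)`. -/
def singletonPartition : PartitionDiagram := ofLabels (u := 0) (l := 1) fun _ => 0

/-- The double singleton partition `↑⊗↑ ∈ P(0,2)`. -/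
def doubleSingleton : PartitionDiagram :=
  ofLabels (u := 0) (l := 2) (Sum.elim (fun i => (i : ℕ)) fun j => (j : ℕ))

/-- The crossing partition `⨯ ∈ P(2,2)`, with blocks `{1,2'}` and `{2,1'}`. -/
def crossing : PartitionDiagram :=
  ofLabels (u := 2) (l := 2) (Sum.elim (fun i => (i : ℕ)) fun j => 1 - (j : ℕ))

/-- The pair positioner partition `▷ ∈ P(3,3)`, with blocks `{1,2,2',3'}` and `{3,1'}`. -/
def pairPositioner : PartitionDiagram :=
  ofLabels (u := 3) (l := 3)
    (Sum.elim (fun i => if (i : ℕ) = 2 then 1 else 0) fun j => if (j : ℕ) = 0 then 1 else 0)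

/-- The partition `k_l ∈ P(l+2, l+2)` consisting of the four block `{1, 1', l+2, (l+2)'}`
together with the pairs `{j, j'}` for `2 ≤ j ≤ l+1`. -/
def kPart (n : ℕ) : PartitionDiagram :=
  ofLabels (u := n + 2) (l := n + 2)
    (fun x => if (Sum.elim Fin.val Fin.val x) = 0 ∨ (Sum.elim Fin.val Fin.val x) = n + 1
      then 0 else Sum.elim Fin.val Fin.val x)

/-- The involution `p* ∈ P(l,k)` of `p ∈ P(k,l)`: turn the partition upside down. -/
def invol (p : PartitionDiagram) : PartitionDiagram :=
  ⟨p.lower, p.upper, Setoid.comap Sum.swap p.rel⟩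

/-- Auxiliary map splitting the points of a tensor product into the points of the two factors. -/
def splitPoint {a b c d : ℕ} (x : Fin (a + b) ⊕ Fin (c + d)) :
    (Fin a ⊕ Fin c) ⊕ (Fin b ⊕ Fin d) :=
  match x with
  | Sum.inl u =>
    match finSumFinEquiv.symm u with
    | Sum.inl i => Sum.inl (Sum.inl i)
    | Sum.inr i => Sum.inr (Sum.inl i)
  | Sum.inr v =>
    match finSumFinEquiv.symm v with
    | Sum.inl j => Sum.inl (Sum.inr j)
    | Sum.inr j => Sum.inr (Sum.inr j)

/-- The tensor product (horizontal concatenation) `p ⊗ q` of two partitions. -/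
def tensor (p q : PartitionDiagram) : PartitionDiagram :=
  ⟨p.upper + q.upper, p.lower + q.lower,
    Setoid.ker fun x =>
      Sum.map (Quotient.mk p.rel) (Quotient.mk q.rel) (splitPoint x)⟩

section Composition

variable (p q : PartitionDiagram) (h : p.lower = q.upper)

/-- Inclusion of the points of `p` into the three-row diagram used for composition. -/
def iotaP : Fin p.upper ⊕ Fin p.lower → Fin p.upper ⊕ (Fin p.lower ⊕ Fin q.lower) :=
  Sum.map id Sum.inl

/-- Inclusion of the points of `q` into the three-row diagram used for composition,
identifying the upper points of `q` with the lower points of `p`. -/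
def iotaQ : Fin q.upper ⊕ Fin q.lower → Fin p.upper ⊕ (Fin p.lower ⊕ Fin q.lower) :=
  fun x => Sum.inr (Sum.map (Fin.cast h.symm) id x)

/-- The generating relation on the three-row diagram used for composition. -/
def compRel : Fin p.upper ⊕ (Fin p.lower ⊕ Fin q.lower) →
    Fin p.upper ⊕ (Fin p.lower ⊕ Fin q.lower) → Prop :=
  fun x y =>
    (∃ a b, p.rel.r a b ∧ x = iotaP p q a ∧ y = iotaP p q b) ∨
    (∃ a b, q.rel.r a b ∧ x = iotaQ p q h a ∧ y = iotaQ p q h b)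

/-- The composition (vertical concatenation) `qp ∈ P(k,m)` of `p ∈ P(k,l)` and `q ∈ P(l,m)`:
identify the lower points of `p` with the upper points of `q`, take the join of the block
structures and restrict to the upper points of `p` and the lower points of `q`. -/
def comp : PartitionDiagram :=
  ⟨p.upper, q.lower,
    Setoid.comap (Sum.map id Sum.inr) (Relation.EqvGen.setoid (compRel p q h))⟩

end Composition

/-- Rotation of the leftmost upper point to the leftmost lower position. -/
def rotLU (p : PartitionDiagram) (h : 0 < p.upper) : PartitionDiagram :=
  ⟨p.upper - 1, p.lower + 1,
    Setoid.comap (fun x => match x with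
      | Sum.inl j => Sum.inl (⟨(j : ℕ) + 1, by have := j.isLt; omega⟩ : Fin p.upper)
      | Sum.inr j => if hj : (j : ℕ) = 0 then Sum.inl (⟨0, h⟩ : Fin p.upper)
          else Sum.inr (⟨(j : ℕ) - 1, by have := j.isLt; omega⟩ : Fin p.lower)) p.rel⟩

/-- Rotation of the leftmost lower point to the leftmost upper position. -/
def rotLD (p : PartitionDiagram) (h : 0 < p.lower) : PartitionDiagram :=
  ⟨p.upper + 1, p.lower - 1,
    Setoid.comap (fun x => match x with
      | Sum.inl j => if hj : (j : ℕ) = 0 then Sum.inr (⟨0, h⟩ : Fin p.lower)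
          else Sum.inl (⟨(j : ℕ) - 1, by have := j.isLt; omega⟩ : Fin p.upper)
      | Sum.inr j => Sum.inr (⟨(j : ℕ) + 1, by have := j.isLt; omega⟩ : Fin p.lower)) p.rel⟩

/-- Rotation of the rightmost upper point to the rightmost lower position. -/
def rotRU (p : PartitionDiagram) (h : 0 < p.upper) : PartitionDiagram :=
  ⟨p.upper - 1, p.lower + 1,
    Setoid.comap (fun x => match x with
      | Sum.inl j => Sum.inl (⟨(j : ℕ), by have := j.isLt; omega⟩ : Fin p.upper)
      | Sum.inr j => if hj : (j : ℕ) < p.lower then Sum.inr (⟨(j : ℕ), hj⟩ : Fin p.lower)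
          else Sum.inl (⟨p.upper - 1, by omega⟩ : Fin p.upper)) p.rel⟩

/-- Rotation of the rightmost lower point to the rightmost upper position. -/
def rotRD (p : PartitionDiagram) (h : 0 < p.lower) : PartitionDiagram :=
  ⟨p.upper + 1, p.lower - 1,
    Setoid.comap (fun x => match x with
      | Sum.inl j => if hj : (j : ℕ) < p.upper then Sum.inl (⟨(j : ℕ), hj⟩ : Fin p.upper)
          else Sum.inr (⟨p.lower - 1, by omega⟩ : Fin p.lower)
      | Sum.inr j => Sum.inr (⟨(j : ℕ), by have := j.isLt; omega⟩ : Fin p.lower)) p.rel⟩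

/-- The partition obtained from `p` by merging the block of the point `a` and the block of
the point `b` into a single block, leaving all other blocks unchanged. -/
noncomputable def mergeBlocks (p : PartitionDiagram)
    (a b : Fin p.upper ⊕ Fin p.lower) : PartitionDiagram :=
  ⟨p.upper, p.lower,
    Setoid.ker fun x =>
      if p.rel.r x a ∨ p.rel.r x b then (none : Option (Quotient p.rel))
      else some (Quotient.mk p.rel x)⟩

end PartitionDiagram

open PartitionDiagram

/-- A set of partitions is a category of partitions if it contains the identity partition and
the pair partition and is closed under tensor products, composition, involution and the four
rotation operations. -/
structure IsPartitionCategory (M : Set PartitionDiagram) : Prop where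
  id_mem : idPartition ∈ M
  pair_mem : pairPartition ∈ M
  tensor_mem : ∀ p ∈ M, ∀ q ∈ M, tensor p q ∈ M
  comp_mem : ∀ p ∈ M, ∀ q ∈ M, ∀ h : p.lower = q.upper, comp p q h ∈ M
  invol_mem : ∀ p ∈ M, invol p ∈ M
  rotLU_mem : ∀ p ∈ M, ∀ h : 0 < p.upper, rotLU p h ∈ M
  rotLD_mem : ∀ p ∈ M, ∀ h : 0 < p.lower, rotLD p h ∈ M
  rotRU_mem : ∀ p ∈ M, ∀ h : 0 < p.upper, rotRU p h ∈ M
  rotRD_mem : ∀ p ∈ M, ∀ h : 0 < p.lower, rotRD p h ∈ M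

/-- A category of partitions is group-theoretical if it contains the pair positioner
partition `▷`. -/
def IsGroupTheoreticalCategory (M : Set PartitionDiagram) : Prop :=
  IsPartitionCategory M ∧ pairPositioner ∈ M

/-- The smallest category of partitions containing a given set of partitions. -/
def generatedCategory (S : Set PartitionDiagram) : Set PartitionDiagram :=
  ⋂₀ { M | IsPartitionCategory M ∧ S ⊆ M }

/-- The group `Z_2^{*∞}`: the free product of countably many copies of the cyclic group of
order two. -/
abbrev FreeZ2 := Monoid.CoprodI (fun _ : ℕ => Multiplicative (ZMod 2))

/-- The free generators `a_1, a_2, …` of `Z_2^{*∞}`, each of order two. -/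
def gen (n : ℕ) : FreeZ2 :=
  Monoid.CoprodI.of (i := n) (Multiplicative.ofAdd (1 : ZMod 2))

/-- A labelling of a partition assigns (indices of) pairwise distinct generators of
`Z_2^{*∞}` to the blocks: two points receive the same label iff they lie in the same block. -/
def IsLabelling (p : PartitionDiagram) (lab : Fin p.upper ⊕ Fin p.lower → ℕ) : Prop :=
  ∀ x y, lab x = lab y ↔ p.rel.r x y

/-- The word `w(p,l) ∈ Z_2^{*∞}` of a labelled partition: after rotating all upper points to
the right-hand end of the lower row, read off the generators assigned to the points from left
to right, i.e. read the lower points from left to right and then the upper points from right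
to left. -/
def wordOf (p : PartitionDiagram) (lab : Fin p.upper ⊕ Fin p.lower → ℕ) : FreeZ2 :=
  ((List.ofFn fun j : Fin p.lower => gen (lab (Sum.inr j))) ++
    (List.ofFn fun i : Fin p.upper => gen (lab (Sum.inl i))).reverse).prod

/-- `F(C) ⊆ Z_2^{*∞}` is the set of all `w(p,l)` where `p ∈ C` and `l` is a labelling. -/
def Fmap (M : Set PartitionDiagram) : Set FreeZ2 :=
  { g | ∃ p ∈ M, ∃ lab, IsLabelling p lab ∧ wordOf p lab = g }

/-- The set of partitions admitting a labelling whose word lies in `H`. -/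
def catOf (H : Set FreeZ2) : Set PartitionDiagram :=
  { p | ∃ lab, IsLabelling p lab ∧ wordOf p lab ∈ H }

/-- The endomorphism of `Z_2^{*∞}` identifying letters according to `f`, i.e. sending
`a_k` to `a_{f k}` for every `k`. -/
def identifyLetters (f : ℕ → ℕ) : Monoid.End FreeZ2 :=
  Monoid.CoprodI.lift fun i =>
    (Monoid.CoprodI.of (M := fun _ : ℕ => Multiplicative (ZMod 2)) (i := f i))

/-- The strong symmetric semigroup `sS_∞`: the subsemigroup of `End(Z_2^{*∞})` generated by
the finite identifications of letters. -/
def strongSymmetricSemigroup : Subsemigroup (Monoid.End FreeZ2) :=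
  Subsemigroup.closure
    { φ | ∃ f : ℕ → ℕ, (∃ n : ℕ, ∀ k, n ≤ k → f k = k) ∧ φ = identifyLetters f }

/-- A subset of `Z_2^{*∞}` is `sS_∞`-invariant if it is preserved by every element of the
strong symmetric semigroup. -/
def IsSSInvariant (H : Set FreeZ2) : Prop :=
  ∀ φ ∈ strongSymmetricSemigroup, ∀ g ∈ H, φ g ∈ H

/-- A partition is in single leg form if it has no upper points and no two consecutive
points belong to the same block. -/
def IsSingleLeg (p : PartitionDiagram) : Prop :=
  p.upper = 0 ∧
    ∀ i j : Fin p.lower, (j : ℕ) = (i : ℕ) + 1 → ¬ p.rel.r (Sum.inr i) (Sum.inr j)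

/-- `C_sl`: the set of all partitions in `C` with no upper points in single leg form. -/
def slSet (M : Set PartitionDiagram) : Set PartitionDiagram :=
  { p ∈ M | IsSingleLeg p }

/-- The partition with no upper points determined by a word (a list of letters): two points
lie in the same block iff the corresponding letters coincide. -/
def wordPartition (w : List ℕ) : PartitionDiagram :=
  ofLabels (u := 0) (l := w.length) (Sum.elim (fun i => (i : ℕ)) fun j => w.get j)

/-- The canonical letter of the block of a lower point: the least index of a point in its
block. -/
noncomputable def blockLabel (p : PartitionDiagram) (j : Fin p.lower) : ℕ :=
  sInf { i : ℕ | ∃ h : i < p.lower, p.rel.r (Sum.inr ⟨i, h⟩) (Sum.inr j) }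

/-- The canonical word of a partition with no upper points. -/
noncomputable def canonWord (p : PartitionDiagram) : List ℕ :=
  List.ofFn fun j : Fin p.lower => blockLabel p j

/-- Full reduction of a word over an alphabet of involutions: repeatedly delete adjacent
equal pairs of letters.  This computes the result of iterating the operation replacing every
exponent in the run-decomposition of the word by its parity. -/
def reduceWord (w : List ℕ) : List ℕ :=
  w.foldr (fun x acc => match acc with
    | [] => [x]
    | y :: rest => if x = y then rest else x :: y :: rest) []

/-- The single leg version of a partition with no upper points: the unique partition in
single leg form obtained by iteratively replacing every exponent in its run-decomposition by
its parity. -/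
noncomputable def singleLegVersion (p : PartitionDiagram) : PartitionDiagram :=
  wordPartition (reduceWord (canonWord p))

/-- The partition whose upper and lower points are labelled by the letters of two words. -/
def wordDiagram (u v : List ℕ) : PartitionDiagram :=
  ofLabels (u := u.length) (l := v.length) (Sum.elim u.get v.get)

theorem isLabelling_wordDiagram (u v : List ℕ) :
    IsLabelling (wordDiagram u v) (Sum.elim u.get v.get) :=
  fun _ _ => Iff.rfl

theorem eq_wordDiagram {p : PartitionDiagram} {lab : Fin p.upper ⊕ Fin p.lower → ℕ}
    (hlab : IsLabelling p lab) {u v : List ℕ} (hul : p.upper = u.length)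
    (hvl : p.lower = v.length)
    (hu : ∀ i (hi : i < p.upper) (hi' : i < u.length), lab (Sum.inl ⟨i, hi⟩) = u[i])
    (hv : ∀ i (hi : i < p.lower) (hi' : i < v.length), lab (Sum.inr ⟨i, hi⟩) = v[i]) :
    p = wordDiagram u v := by
  obtain ⟨k, l, r⟩ := p
  subst hul hvl
  obtain rfl : lab = Sum.elim u.get v.get := by
    ext (i | j)
    · exact hu i i.2 i.2
    · exact hv j j.2 j.2
  obtain rfl : r = Setoid.ker (Sum.elim u.get v.get) :=
    Setoid.ext fun x y => (hlab x y).symm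
  rfl

theorem wordDiagram_map_of_injOn {f : ℕ → ℕ} {u v : List ℕ}
    (hf : ∀ x ∈ u ++ v, ∀ y ∈ u ++ v, f x = f y → x = y) :
    wordDiagram u v = wordDiagram (u.map f) (v.map f) := by
  have hmem : ∀ x : Fin u.length ⊕ Fin v.length, Sum.elim u.get v.get x ∈ u ++ v := by
    rintro (i | j) <;> simp
  refine eq_wordDiagram (lab := fun x => f (Sum.elim u.get v.get x)) (fun x y => ?_)
    (List.length_map f).symm (List.length_map f).symm (fun i hi hi' => ?_) (fun i hi hi' => ?_)
  · exact ⟨fun h => hf _ (hmem x) _ (hmem y) h, fun h => congrArg f h⟩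
  · exact (List.getElem_map f).symm
  · exact (List.getElem_map f).symm

namespace IsPartitionCategory

variable {M : Set PartitionDiagram}

theorem wordDiagram_comp_mem (hM : IsPartitionCategory M) {u v v₁ v₂ : List ℕ} (h f : ℕ → ℕ)
    (hp : wordDiagram u v ∈ M) (hq : wordDiagram v₁ v₂ ∈ M) (hvf : v.map h = v₁.map f)
    (hsub : ∀ c ∈ v₂, c ∈ v₁)
    (hmerge : ∀ x ∈ u ++ v, ∀ y ∈ u ++ v, h x = h y → x = y ∨
      ∃ i j, ∃ (hi : i < v.length) (hj : j < v.length) (hi' : i < v₁.length)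
        (hj' : j < v₁.length), v[i] = x ∧ v[j] = y ∧ v₁[i] = v₁[j]) :
    wordDiagram (u.map h) (v₂.map f) ∈ M := by
  have hlen : v.length = v₁.length := by simpa using congrArg List.length hvf
  have hget : ∀ i (hi : i < v.length) (hi' : i < v₁.length), h v[i] = f v₁[i] := by
    intro i hi hi'
    have := List.getElem_of_eq hvf (i := i) (by simpa using hi)
    simpa using this
  set p := wordDiagram u v
  set q := wordDiagram v₁ v₂
  have hpq : p.lower = q.upper := hlen
  have key : comp p q hpq = wordDiagram (u.map h) (v₂.map f) := by
    let labP : Fin u.length ⊕ Fin v.length → ℕ := Sum.elim u.get v.get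
    have hlabP : ∀ P, labP P ∈ u ++ v := by rintro (i | j) <;> simp [labP]
    let lab : Fin u.length ⊕ Fin v₂.length → ℕ :=
      Sum.elim (fun i => h (u.get i)) (fun j => f (v₂.get j))
    let E := Relation.EqvGen (compRel p q hpq)
    let emb : Fin u.length ⊕ Fin v₂.length →
        Fin u.length ⊕ (Fin v.length ⊕ Fin v₂.length) := Sum.map id Sum.inr
    have hP : ∀ P Q : Fin u.length ⊕ Fin v.length, labP P = labP Q →
        E (iotaP p q P) (iotaP p q Q) := fun P Q hPQ =>
      .rel _ _ (Or.inl ⟨P, Q, hPQ, rfl, rfl⟩)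
    have hQ : ∀ P Q : Fin v₁.length ⊕ Fin v₂.length,
        Sum.elim v₁.get v₂.get P = Sum.elim v₁.get v₂.get Q →
        E (iotaQ p q hpq P) (iotaQ p q hpq Q) := fun P Q hPQ =>
      .rel _ _ (Or.inr ⟨P, Q, hPQ, rfl, rfl⟩)
    have lift : ∀ x : Fin u.length ⊕ Fin v₂.length, ∃ P : Fin u.length ⊕ Fin v.length,
        E (emb x) (iotaP p q P) ∧ h (labP P) = lab x := by
      rintro (i | j)
      · exact ⟨Sum.inl i, .refl _, rfl⟩
      · obtain ⟨i, hi, hij⟩ := List.getElem_of_mem (hsub _ (v₂.get_mem j))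
        refine ⟨Sum.inr ⟨i, hlen ▸ hi⟩, ?_, ?_⟩
        · exact hQ (Sum.inr j) (Sum.inl ⟨i, hi⟩) hij.symm
        · change h v[i] = f (v₂.get j)
          rw [hget i _ hi, hij]
    have link : ∀ P Q : Fin u.length ⊕ Fin v.length, h (labP P) = h (labP Q) →
        E (iotaP p q P) (iotaP p q Q) := by
      intro P Q hPQ
      rcases hmerge _ (hlabP P) _ (hlabP Q) hPQ with hx | ⟨i, j, hi, hj, hi', hj', h1, h2, h3⟩
      · exact hP _ _ hx
      · refine .trans _ _ _ (hP P (Sum.inr ⟨i, hi⟩) h1.symm) (.trans _ _ _ ?_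
          (hP (Sum.inr ⟨j, hj⟩) Q h2))
        exact hQ (Sum.inl ⟨i, hi'⟩) (Sum.inl ⟨j, hj'⟩) h3
    let g : Fin u.length ⊕ (Fin v.length ⊕ Fin v₂.length) → ℕ :=
      Sum.elim (fun i => h (u.get i))
        (Sum.elim (fun i => h (v.get i)) (fun j => f (v₂.get j)))
    have hgP : ∀ P, g (iotaP p q P) = h (labP P) := by rintro (i | j) <;> rfl
    have hgQ : ∀ P, g (iotaQ p q hpq P) = f (Sum.elim v₁.get v₂.get P) := by
      rintro (i | j)
      · exact hget i (hlen ▸ i.2) i.2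
      · rfl
    have hgemb : ∀ x, g (emb x) = lab x := by rintro (i | j) <;> rfl
    have hg : ∀ x y, E x y → g x = g y := by
      intro x y hxy
      induction hxy with
      | rel x y hr =>
        rcases hr with ⟨a, b, hab, rfl, rfl⟩ | ⟨a, b, hab, rfl, rfl⟩
        · rw [hgP, hgP]; exact congrArg h hab
        · rw [hgQ, hgQ]; exact congrArg f hab
      | refl => rfl
      | symm _ _ _ ih => exact ih.symm
      | trans _ _ _ _ _ ih₁ ih₂ => exact ih₁.trans ih₂
    refine eq_wordDiagram (lab := lab) (fun x y => ?_) (List.length_map h).symm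
      (List.length_map f).symm (fun i hi hi' => ?_) (fun i hi hi' => ?_)
    · change _ ↔ E (emb x) (emb y)
      refine ⟨fun hxy => ?_, fun hxy => ?_⟩
      swap
      · exact (hgemb x).symm.trans ((hg _ _ hxy).trans (hgemb y))
      obtain ⟨P, hP₁, hP₂⟩ := lift x
      obtain ⟨Q, hQ₁, hQ₂⟩ := lift y
      exact .trans _ _ _ hP₁ (.trans _ _ _ (link P Q (by rw [hP₂, hQ₂, hxy])) (.symm _ _ hQ₁))
    · exact (List.getElem_map h).symm
    · exact (List.getElem_map f).symm
  exact key ▸ hM.comp_mem p hp q hq hpq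

theorem wordDiagram_invol_mem (hM : IsPartitionCategory M) {u v : List ℕ}
    (h : wordDiagram u v ∈ M) : wordDiagram v u ∈ M := by
  have key : invol (wordDiagram u v) = wordDiagram v u := by
    refine eq_wordDiagram (lab := Sum.elim v.get u.get) (fun x y => ?_) rfl rfl
      (fun _ _ _ => rfl) (fun _ _ _ => rfl)
    rcases x with x | x <;> rcases y with y | y <;> exact Iff.rfl
  exact key ▸ hM.invol_mem _ h

theorem wordDiagram_rotLD_mem (hM : IsPartitionCategory M) {u v : List ℕ} {x : ℕ}
    (h : wordDiagram u (x :: v) ∈ M) : wordDiagram (x :: u) v ∈ M := by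
  have key : rotLD (wordDiagram u (x :: v)) (Nat.succ_pos _) = wordDiagram (x :: u) v := by
    refine eq_wordDiagram (lab := fun z => Sum.elim u.get (x :: v).get _)
      (fun _ _ => Iff.rfl) rfl rfl ?_ (fun _ _ _ => rfl)
    rintro (_ | i) h₁ h₂ <;> rfl
  exact key ▸ hM.rotLD_mem _ h _

theorem wordDiagram_rotRU_mem (hM : IsPartitionCategory M) {u v : List ℕ} {x : ℕ}
    (h : wordDiagram (u ++ [x]) v ∈ M) : wordDiagram u (v ++ [x]) ∈ M := by
  have hpos : 0 < (wordDiagram (u ++ [x]) v).upper := by simp [wordDiagram, ofLabels]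
  have key : rotRU (wordDiagram (u ++ [x]) v) hpos = wordDiagram u (v ++ [x]) := by
    refine eq_wordDiagram (lab := fun z => Sum.elim (u ++ [x]).get v.get _)
      (fun _ _ => Iff.rfl) (by simp [rotRU, wordDiagram, ofLabels])
      (by simp [rotRU, wordDiagram, ofLabels]) (fun i h₁ h₂ => ?_) (fun i h₁ h₂ => ?_)
    · exact List.getElem_append_left h₂
    · change Sum.elim (u ++ [x]).get v.get (if hj : i < v.length then Sum.inr ⟨i, hj⟩
        else Sum.inl ⟨(u ++ [x]).length - 1, by simp⟩) = _
      by_cases hi : i < v.length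
      · rw [dif_pos hi]
        exact (List.getElem_append_left hi).symm
      · rw [dif_neg hi]
        simp [List.getElem_append, hi]
  exact key ▸ hM.rotRU_mem _ h _

theorem wordDiagram_rotRD_mem (hM : IsPartitionCategory M) {u v : List ℕ} {x : ℕ}
    (h : wordDiagram u (v ++ [x]) ∈ M) : wordDiagram (u ++ [x]) v ∈ M :=
  hM.wordDiagram_invol_mem (hM.wordDiagram_rotRU_mem (hM.wordDiagram_invol_mem h))

theorem wordDiagram_mem_iff (hM : IsPartitionCategory M) {u v : List ℕ} :
    wordDiagram u v ∈ M ↔ wordDiagram [] (v ++ u.reverse) ∈ M := by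
  induction u using List.reverseRecOn generalizing v with
  | nil => simp
  | append_singleton u x ih =>
    have : wordDiagram (u ++ [x]) v ∈ M ↔ wordDiagram u (v ++ [x]) ∈ M :=
      ⟨hM.wordDiagram_rotRU_mem, hM.wordDiagram_rotRD_mem⟩
    rw [this, ih]
    simp

theorem wordDiagram_tensor_mem (hM : IsPartitionCategory M) {v w : List ℕ}
    (hv : wordDiagram [] v ∈ M) (hw : wordDiagram [] w ∈ M) (hvw : v.Disjoint w) :
    wordDiagram [] (v ++ w) ∈ M := by
  let lab : (Fin 0 ⊕ Fin v.length) ⊕ (Fin 0 ⊕ Fin w.length) → ℕ :=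
    Sum.elim (Sum.elim [].get v.get) (Sum.elim [].get w.get)
  have hlab : ∀ x y, lab x = lab y ↔
      Sum.map (Quotient.mk (wordDiagram [] v).rel) (Quotient.mk (wordDiagram [] w).rel) x =
      Sum.map (Quotient.mk (wordDiagram [] v).rel) (Quotient.mk (wordDiagram [] w).rel) y := by
    rintro ((i | i) | (i | i)) ((j | j) | (j | j)) <;>
      first | exact i.elim0 | exact j.elim0 | skip
    · exact Iff.symm (Sum.inl_injective.eq_iff.trans Quotient.eq)
    · exact iff_of_false (fun h : v.get i = w.get j => hvw (v.get_mem i) (h ▸ w.get_mem j))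
        Sum.inl_ne_inr
    · exact iff_of_false (fun h : w.get i = v.get j => hvw (v.get_mem j) (h ▸ w.get_mem i))
        Sum.inr_ne_inl
    · exact Iff.symm (Sum.inr_injective.eq_iff.trans Quotient.eq)
  have key : tensor (wordDiagram [] v) (wordDiagram [] w) = wordDiagram [] (v ++ w) := by
    refine eq_wordDiagram (lab := fun z => lab (splitPoint z))
      (fun x y => hlab (splitPoint x) (splitPoint y)) rfl List.length_append.symm
      (fun i _ hi => absurd hi (Nat.not_lt_zero i)) (fun i h₁ h₂ => ?_)
    by_cases hi : i < v.length
    · have : (finSumFinEquiv.symm (⟨i, h₁⟩ : Fin (v.length + w.length))) = Sum.inl ⟨i, hi⟩ :=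
        finSumFinEquiv_symm_apply_castAdd (⟨i, hi⟩ : Fin v.length)
      change lab (splitPoint (Sum.inr (⟨i, h₁⟩ : Fin (v.length + w.length)))) = _
      simp only [splitPoint, this]
      exact (List.getElem_append_left hi).symm
    · obtain ⟨j, rfl⟩ := Nat.exists_eq_add_of_le (not_lt.mp hi)
      have hj : j < w.length := by simpa using h₂
      have : (finSumFinEquiv.symm (⟨v.length + j, h₁⟩ : Fin (v.length + w.length))) =
          Sum.inr ⟨j, hj⟩ := finSumFinEquiv_symm_apply_natAdd (⟨j, hj⟩ : Fin w.length)
      change lab (splitPoint (Sum.inr (⟨v.length + j, h₁⟩ : Fin (v.length + w.length)))) = _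
      simp only [splitPoint, this]
      simp [lab]
  exact key ▸ hM.tensor_mem _ hv _ hw

theorem word_mem_iff (hM : IsPartitionCategory M) {s t : List ℕ} :
    wordDiagram [] (s ++ t) ∈ M ↔ wordDiagram t.reverse s ∈ M := by
  rw [hM.wordDiagram_mem_iff (u := t.reverse), List.reverse_reverse]

theorem word_rotate_mem (hM : IsPartitionCategory M) {s t : List ℕ}
    (h : wordDiagram [] (s ++ t) ∈ M) : wordDiagram [] (t ++ s) ∈ M := by
  induction s generalizing t with
  | nil => simpa using h
  | cons x s ih =>
    have h' : wordDiagram [] (s ++ t ++ [x]) ∈ M :=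
      hM.wordDiagram_rotRU_mem (u := []) (hM.wordDiagram_rotLD_mem h)
    rw [List.append_assoc] at h'
    simpa using ih h'

theorem word_reverse_mem (hM : IsPartitionCategory M) {w : List ℕ}
    (h : wordDiagram [] w ∈ M) : wordDiagram [] w.reverse ∈ M := by
  simpa using hM.wordDiagram_mem_iff.mp (hM.wordDiagram_invol_mem h)

theorem word_map_mem_of_injOn {f : ℕ → ℕ} {w : List ℕ} (h : wordDiagram [] w ∈ M)
    (hf : ∀ x ∈ w, ∀ y ∈ w, f x = f y → x = y) : wordDiagram [] (w.map f) ∈ M :=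
  wordDiagram_map_of_injOn (u := []) hf ▸ h

theorem word_pair_mem (hM : IsPartitionCategory M) (x : ℕ) : wordDiagram [] [x, x] ∈ M := by
  have key : pairPartition = wordDiagram [] [x, x] :=
    eq_wordDiagram (lab := fun _ => x) (fun _ _ => iff_of_true rfl rfl) rfl rfl
      (fun i hi => absurd hi (Nat.not_lt_zero i)) (by
        rintro (_ | _ | i) hi hi'
        · rfl
        · rfl
        · simp at hi')
  exact key ▸ hM.pair_mem

/-- Composing the first letters of a word with a diagram whose upper labels match them. -/
theorem word_comp_mem (hM : IsPartitionCategory M) {v w v₁ v₂ : List ℕ} (f : ℕ → ℕ)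
    (hp : wordDiagram [] (v ++ w) ∈ M) (hq : wordDiagram v₁ v₂ ∈ M) (hvf : v = v₁.map f)
    (hsub : ∀ c ∈ v₂, c ∈ v₁) : wordDiagram [] (v₂.map f ++ w) ∈ M := by
  rw [hM.word_mem_iff] at hp ⊢
  simpa using hM.wordDiagram_comp_mem id f hp hq (by simpa using hvf) hsub
    (fun x _ y _ hxy => Or.inl hxy)

theorem word_cancel_mem (hM : IsPartitionCategory M) {x : ℕ} {w : List ℕ}
    (h : wordDiagram [] (x :: x :: w) ∈ M) : wordDiagram [] w ∈ M :=
  hM.word_comp_mem (v := [x, x]) (v₁ := [0, 0]) (v₂ := []) (fun _ => x) h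
    (hM.wordDiagram_invol_mem (hM.word_pair_mem 0)) rfl (by simp)

end IsPartitionCategory

namespace IsGroupTheoreticalCategory

variable {M : Set PartitionDiagram}

theorem wordDiagram_pairPositioner_mem (hM : IsGroupTheoreticalCategory M) :
    wordDiagram [0, 0, 1] [1, 0, 0] ∈ M := by
  have key : pairPositioner = wordDiagram [0, 0, 1] [1, 0, 0] :=
    eq_wordDiagram (fun _ _ => Iff.rfl) rfl rfl
      (by
        rintro (_ | _ | _ | i) hi hi'
        · rfl
        · rfl
        · rfl
        · simp at hi'
          omega)
      (by
        rintro (_ | _ | _ | i) hi hi'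
        · rfl
        · rfl
        · rfl
        · simp at hi'
          omega)
  exact key ▸ hM.2

theorem word_swap_pair_mem (hM : IsGroupTheoreticalCategory M) {a c : ℕ} {w : List ℕ}
    (h : wordDiagram [] (a :: a :: c :: w) ∈ M) : wordDiagram [] (c :: a :: a :: w) ∈ M :=
  hM.1.word_comp_mem (v := [a, a, c]) (fun n => if n = 0 then a else c) h
    hM.wordDiagram_pairPositioner_mem (by simp) (by simp)

theorem word_move_pair_mem (hM : IsGroupTheoreticalCategory M) {a : ℕ} {m t : List ℕ}
    (h : wordDiagram [] (a :: a :: (m ++ t)) ∈ M) :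
    wordDiagram [] (m ++ a :: a :: t) ∈ M := by
  induction m generalizing t with
  | nil => exact h
  | cons c m ih =>
    have h₁ := hM.1.word_rotate_mem (s := [c]) (hM.word_swap_pair_mem h)
    have h₂ := ih (t := t ++ [c]) (by simpa using h₁)
    simpa using hM.1.word_rotate_mem (s := m ++ a :: a :: t) (t := [c]) (by simpa using h₂)

theorem wordDiagram_fourBlock_mem (hM : IsGroupTheoreticalCategory M) :
    wordDiagram [0, 0] [0, 0] ∈ M := by
  have h₁ : wordDiagram [] [1, 0, 0, 1, 0, 0] ∈ M :=
    hM.1.wordDiagram_mem_iff.mp hM.wordDiagram_pairPositioner_mem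
  have h₂ : wordDiagram [] [0, 0, 1, 0, 0, 1] ∈ M := hM.1.word_rotate_mem (s := [1]) h₁
  have h₃ : wordDiagram [] [1, 1, 0, 0, 0, 0] ∈ M :=
    hM.1.word_rotate_mem (s := [1, 0, 0, 0, 0]) (hM.word_swap_pair_mem h₂)
  exact (hM.1.word_mem_iff (s := [0, 0]) (t := [0, 0])).mp (hM.1.word_cancel_mem h₃)

theorem word_merge_adjacent_mem (hM : IsGroupTheoreticalCategory M) {a b : ℕ} {w : List ℕ}
    (h : wordDiagram [] (a :: b :: w) ∈ M) :
    wordDiagram [] (b :: b :: w.map fun z => if z = a then b else z) ∈ M := by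
  have hp : wordDiagram w.reverse [a, b] ∈ M := (hM.1.word_mem_iff (s := [a, b])).mp h
  have := hM.1.wordDiagram_comp_mem (fun z => if z = a then b else z) (fun _ => b) hp
    hM.wordDiagram_fourBlock_mem (by simp) (by simp) (fun x _ y _ hxy => ?_)
  · rw [List.map_reverse] at this
    exact (hM.1.word_mem_iff (s := [b, b])).mpr this
  · split_ifs at hxy with hx hy hy
    · exact Or.inl (hx.trans hy.symm)
    · exact Or.inr ⟨0, 1, by simp, by simp, by simp, by simp, hx.symm, hxy, rfl⟩
    · exact Or.inr ⟨1, 0, by simp, by simp, by simp, by simp, hxy.symm, hy.symm, rfl⟩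
    · exact Or.inl hxy

theorem word_triple_mem (hM : IsGroupTheoreticalCategory M) {a : ℕ} {w : List ℕ}
    (h : wordDiagram [] (a :: w) ∈ M) : wordDiagram [] (a :: a :: a :: w) ∈ M := by
  obtain ⟨x, hx⟩ := Infinite.exists_notMem_finset (a :: w).toFinset
  rw [List.mem_toFinset] at hx
  have hxw : ∀ z ∈ w, z ≠ x := fun z hz hzx => hx (hzx ▸ List.mem_cons_of_mem _ hz)
  have h₁ : wordDiagram [] ([x, x] ++ a :: w) ∈ M :=
    hM.1.wordDiagram_tensor_mem (hM.1.word_pair_mem x) h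
      (fun z hz hz' => hx (by simp at hz; exact hz ▸ hz'))
  have h₂ := hM.word_merge_adjacent_mem (w := w ++ [x])
    (hM.1.word_rotate_mem (s := [x]) (t := x :: a :: w) h₁)
  have h₃ : (w ++ [x]).map (fun z => if z = x then a else z) = w ++ [a] := by
    rw [List.map_append,
      (List.map_congr_left fun z hz => if_neg (hxw z hz) : w.map _ = w.map fun z => z)]
    simp
  rw [h₃] at h₂
  exact hM.1.word_rotate_mem (s := a :: a :: w) (t := [a]) h₂

theorem word_merge_mem (hM : IsGroupTheoreticalCategory M) {a b : ℕ} {w : List ℕ}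
    (h : wordDiagram [] w ∈ M) (ha : a ∈ w) (hb : b ∈ w) (hab : a ≠ b) :
    wordDiagram [] (w.map fun z => if z = a then b else z) ∈ M := by
  obtain ⟨s, t, rfl⟩ := List.append_of_mem ha
  have hb' : b ∈ t ++ s := by
    simp only [List.mem_append, List.mem_cons] at hb ⊢
    tauto
  obtain ⟨m, v, hmv⟩ := List.append_of_mem hb'
  have h₁ : wordDiagram [] (a :: (m ++ b :: v)) ∈ M := by
    rw [← hmv]
    exact hM.1.word_rotate_mem h
  have h₂ := hM.1.word_rotate_mem (s := [a]) (hM.word_triple_mem h₁)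
  have h₃ := hM.word_move_pair_mem (m := m) (t := b :: v ++ [a]) (by simpa using h₂)
  have h₄ := hM.1.word_rotate_mem (s := m ++ [a]) (t := a :: b :: (v ++ [a]))
    (by simpa using h₃)
  have h₅ := hM.1.word_cancel_mem (hM.word_merge_adjacent_mem h₄)
  set σ : ℕ → ℕ := fun z => if z = a then b else z
  have hσa : σ a = b := if_pos rfl
  have hσb : σ b = b := if_neg hab.symm
  have h₆ := hM.1.word_rotate_mem (s := v.map σ) (t := b :: m.map σ ++ [b])
    (by simpa [hσa] using h₅)
  have h₇ : wordDiagram [] (b :: (t ++ s).map σ) ∈ M := by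
    rw [hmv]
    simpa [hσb] using h₆
  have h₈ := hM.1.word_rotate_mem (s := b :: t.map σ) (t := s.map σ) (by simpa using h₇)
  simpa [hσa] using h₈

theorem word_map_mem (hM : IsGroupTheoreticalCategory M) (f : ℕ → ℕ) {w : List ℕ}
    (h : wordDiagram [] w ∈ M) : wordDiagram [] (w.map f) ∈ M := by
  induction hn : w.toFinset.card using Nat.strong_induction_on generalizing w with
  | _ n ih =>
    by_cases hf : ∀ x ∈ w, ∀ y ∈ w, f x = f y → x = y
    · exact IsPartitionCategory.word_map_mem_of_injOn h hf
    push Not at hf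
    obtain ⟨a, ha, b, hb, hfab, hab⟩ := hf
    set σ : ℕ → ℕ := fun z => if z = a then b else z with hσ
    have hfσ : f ∘ σ = f := by
      ext z
      by_cases hz : z = a <;> simp [hσ, hz, hfab]
    have hsub : (w.map σ).toFinset ⊂ w.toFinset := by
      refine (Finset.ssubset_iff_of_subset ?_).mpr ⟨a, List.mem_toFinset.mpr ha, ?_⟩
      · intro z
        simp only [List.mem_toFinset, List.mem_map]
        rintro ⟨y, hy, rfl⟩
        simp only [hσ]
        split_ifs <;> assumption
      · simp only [List.mem_toFinset, List.mem_map, not_exists, not_and]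
        intro y _ hya
        simp only [hσ] at hya
        split_ifs at hya with hy
        · exact hab hya.symm
        · exact hy hya
    have := ih _ (hn ▸ Finset.card_lt_card hsub) (hM.word_merge_mem h ha hb hab) rfl
    rwa [List.map_map, hfσ] at this

theorem word_append_mem (hM : IsGroupTheoreticalCategory M) {v w : List ℕ}
    (hv : wordDiagram [] v ∈ M) (hw : wordDiagram [] w ∈ M) :
    wordDiagram [] (v ++ w) ∈ M := by
  have h := hM.word_map_mem (fun n => n / 2) (hM.1.wordDiagram_tensor_mem
    (hM.word_map_mem (fun n => 2 * n) hv) (hM.word_map_mem (fun n => 2 * n + 1) hw) ?_)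
  · have h₁ : (fun n => n / 2) ∘ (fun n => 2 * n) = id := by ext n; simp
    have h₂ : (fun n => n / 2) ∘ (fun n => 2 * n + 1) = id := by ext n; simp; omega
    simpa only [List.map_append, List.map_map, h₁, h₂, List.map_id] using h
  · intro z hz hz'
    simp only [List.mem_map] at hz hz'
    obtain ⟨i, _, hi⟩ := hz
    obtain ⟨j, _, hj⟩ := hz'
    omega

end IsGroupTheoreticalCategory

theorem gen_mul_self (n : ℕ) : gen n * gen n = 1 := by
  rw [gen, ← map_mul]
  exact map_one _

theorem prod_map_gen_reverse (w : List ℕ) :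
    (w.map gen).reverse.prod = ((w.map gen).prod)⁻¹ := by
  induction w with
  | nil => simp
  | cons x w ih =>
    rw [List.map_cons, List.reverse_cons, List.prod_append, ih, List.prod_singleton,
      List.prod_cons, mul_inv_rev, inv_eq_of_mul_eq_one_left (gen_mul_self x)]

theorem identifyLetters_gen (f : ℕ → ℕ) (n : ℕ) : identifyLetters f (gen n) = gen (f n) :=
  Monoid.CoprodI.lift_of _ _

theorem exists_prod_map_gen (g : FreeZ2) : ∃ w : List ℕ, (w.map gen).prod = g := by
  induction g using Monoid.CoprodI.induction_on with
  | one => exact ⟨[], rfl⟩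
  | of i m =>
    obtain rfl | rfl : m = 1 ∨ m = Multiplicative.ofAdd 1 := by
      revert m; decide
    · exact ⟨[], (map_one _).symm⟩
    · exact ⟨[i], by simp [gen]⟩
  | mul x y hx hy =>
    obtain ⟨v, rfl⟩ := hx
    obtain ⟨w, rfl⟩ := hy
    exact ⟨v ++ w, by simp⟩

theorem IsPartitionCategory.mem_Fmap_iff {M : Set PartitionDiagram}
    (hM : IsPartitionCategory M) {g : FreeZ2} :
    g ∈ Fmap M ↔ ∃ w : List ℕ, wordDiagram [] w ∈ M ∧ (w.map gen).prod = g := by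
  constructor
  · rintro ⟨p, hp, lab, hlab, rfl⟩
    have key : p = wordDiagram (List.ofFn fun i => lab (Sum.inl i))
        (List.ofFn fun j => lab (Sum.inr j)) :=
      eq_wordDiagram hlab (by simp) (by simp) (by simp) (by simp)
    refine ⟨_, hM.wordDiagram_mem_iff.mp (key ▸ hp), ?_⟩
    simp [wordOf, List.map_ofFn, Function.comp_def]
  · rintro ⟨w, hw, rfl⟩
    refine ⟨_, hw, _, isLabelling_wordDiagram [] w, ?_⟩
    simp [wordOf, wordDiagram, ofLabels]


/-- For every group-theoretical category of partitions `C`, the normal subgroup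
`F(C)` of `Z_2^{*∞}` is `sS_∞`-invariant: `φ(F(C)) ⊆ F(C)` for every `φ` in the strong
symmetric semigroup `sS_∞`. -/
theorem Fmap_isSSInvariant (M : Set PartitionDiagram)
    (hM : IsGroupTheoreticalCategory M) :
    (∃ H : Subgroup FreeZ2, H.Normal ∧ (H : Set FreeZ2) = Fmap M) ∧
      IsSSInvariant (Fmap M) := by
  refine ⟨⟨{
      carrier := Fmap M
      one_mem' := ?_
      mul_mem' := ?_
      inv_mem' := ?_ }, ⟨?_⟩, rfl⟩, ?_⟩
  · rintro x y hx hy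
    obtain ⟨v, hv, rfl⟩ := hM.1.mem_Fmap_iff.mp hx
    obtain ⟨w, hw, rfl⟩ := hM.1.mem_Fmap_iff.mp hy
    exact hM.1.mem_Fmap_iff.mpr ⟨v ++ w, hM.word_append_mem hv hw, by simp⟩
  · exact hM.1.mem_Fmap_iff.mpr ⟨[], hM.1.word_cancel_mem (hM.1.word_pair_mem 0), rfl⟩
  · rintro x hx
    obtain ⟨v, hv, rfl⟩ := hM.1.mem_Fmap_iff.mp hx
    exact hM.1.mem_Fmap_iff.mpr ⟨v.reverse, hM.1.word_reverse_mem hv, by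
      rw [List.map_reverse, prod_map_gen_reverse]⟩
  · intro x hx g
    obtain ⟨v, hv, rfl⟩ := hM.1.mem_Fmap_iff.mp hx
    obtain ⟨w, rfl⟩ := exists_prod_map_gen g
    have h : wordDiagram [] (w ++ (v ++ w.reverse)) ∈ M := by
      induction w with
      | nil => simpa using hv
      | cons a w ih =>
        have h' := hM.1.word_rotate_mem (s := [a]) (t := a :: (w ++ (v ++ w.reverse)))
          (hM.word_append_mem (v := [a, a]) (hM.1.word_pair_mem a) ih)
        simpa using h'
    exact hM.1.mem_Fmap_iff.mpr ⟨_, h, by simp [prod_map_gen_reverse, mul_assoc]⟩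
  · intro φ hφ
    induction hφ using Subsemigroup.closure_induction with
    | mem φ h =>
      obtain ⟨f, -, rfl⟩ := h
      intro g hg
      obtain ⟨w, hw, rfl⟩ := hM.1.mem_Fmap_iff.mp hg
      refine hM.1.mem_Fmap_iff.mpr ⟨w.map f, hM.word_map_mem f hw, ?_⟩
      rw [map_list_prod, List.map_map, List.map_map]
      exact congrArg _ (List.map_congr_left fun n _ => (identifyLetters_gen f n).symm)
    | mul φ ψ _ _ hφ hψ => exact fun g hg => hφ _ (hψ g hg)
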